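/- Suppose A is Γ-graded D-simple and D ≠ 0. Then A ⊆ [A[D], A[D]], where [A[D],A[D]] is the F-span of all color brackets [x,y] = xy − ε(x̄,ȳ)yx of homogeneous x, y ∈ A[D]. -/

import Mathlib

/-- A skew-symmetric bicharacter `ε : Γ × Γ → F^×`. -/
def IsBichar {F : Type} [Field F] {Γ : Type} [AddCommGroup Γ] (ε : Γ → Γ → F) : Prop :=
  (∀ lam mu, ε lam mu * ε mu lam = 1) ∧
  (∀ lam mu nu, ε lam (mu + nu) = ε lam mu * ε lam nu)

variable (F : Type) [Field F] (Γ : Type) [AddCommGroup Γ] [DecidableEq Γ]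
  (A : Type) [Ring A] [Algebra F A]

/-- left multiplication operators -/
noncomputable def mulL : A →ₗ[F] Module.End F A := (Algebra.lmul F A).toLinearMap

variable {F Γ A}

/-- `f ∈ End_F(A)` is homogeneous of degree `δ`. -/
def IsHomogMap (𝒜 : Γ → Submodule F A) (δ : Γ) (f : Module.End F A) : Prop :=
  ∀ lam : Γ, ∀ a ∈ 𝒜 lam, f a ∈ 𝒜 (lam + δ)

/-- `f` is a homogeneous color-derivation of degree `δ`. -/
def IsColorDer (𝒜 : Γ → Submodule F A) (ε : Γ → Γ → F) (δ : Γ) (f : Module.End F A) : Prop :=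
  IsHomogMap 𝒜 δ f ∧
  ∀ lam : Γ, ∀ a ∈ 𝒜 lam, ∀ b : A, f (a * b) = f a * b + ε δ lam • (a * f b)

/-- `Der^ε(A)`: the F-span of homogeneous color derivations. -/
def DerE (𝒜 : Γ → Submodule F A) (ε : Γ → Γ → F) : Submodule F (Module.End F A) :=
  Submodule.span F {f | ∃ δ, IsColorDer 𝒜 ε δ f}

/-- `A` is ε-commutative. -/
def IsColorComm (𝒜 : Γ → Submodule F A) (ε : Γ → Γ → F) : Prop :=
  ∀ lam mu : Γ, ∀ a ∈ 𝒜 lam, ∀ b ∈ 𝒜 mu, a * b = ε lam mu • (b * a)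

/-- `D` is color-commutative. -/
def DColorComm (𝒜 : Γ → Submodule F A) (ε : Γ → Γ → F) (D : Submodule F (Module.End F A)) : Prop :=
  ∀ δ δ' f g, f ∈ D → g ∈ D → IsColorDer 𝒜 ε δ f → IsColorDer 𝒜 ε δ' g →
    f * g = ε δ δ' • (g * f)

/-- `D` is a Γ-graded subspace: it is spanned by its homogeneous color-derivations. -/
def DGraded (𝒜 : Γ → Submodule F A) (ε : Γ → Γ → F) (D : Submodule F (Module.End F A)) : Prop :=
  D = Submodule.span F {f | f ∈ D ∧ ∃ δ, IsColorDer 𝒜 ε δ f}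

/-- `A[D]`: the unital subalgebra of `End_F(A)` generated by left multiplications and `D`. -/
noncomputable def AD (D : Submodule F (Module.End F A)) : Subalgebra F (Module.End F A) :=
  Algebra.adjoin F (Set.range (mulL F A) ∪ (D : Set (Module.End F A)))

/-- `A` is Γ-graded `D`-simple. -/
def GradedDSimple (𝒜 : Γ → Submodule F A) [GradedAlgebra 𝒜] (D : Submodule F (Module.End F A)) :
    Prop :=
  ∀ I : Ideal A, Ideal.IsHomogeneous 𝒜 I → (∀ f ∈ D, ∀ x ∈ I, f x ∈ I) → I = ⊥ ∨ I = ⊤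

/-- F₁ = A^D -/
def F1 (D : Submodule F (Module.End F A)) : Submodule F A where
  carrier := {u | ∀ f ∈ D, f u = 0}
  add_mem' := by
    intro a b ha hb f hf
    rw [map_add, ha f hf, hb f hf, add_zero]
  zero_mem' := by intro f hf; exact map_zero f
  smul_mem' := by
    intro c x hx f hf
    rw [map_smul, hx f hf, smul_zero]

/-- the derived space `W = [A[D], A[D]]`. -/
def Wsub (𝒜 : Γ → Submodule F A) (ε : Γ → Γ → F) (D : Submodule F (Module.End F A)) :
    Submodule F (Module.End F A) :=
  Submodule.span F {w | ∃ γ γ' x y, x ∈ AD D ∧ y ∈ AD D ∧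
    IsHomogMap 𝒜 γ x ∧ IsHomogMap 𝒜 γ' y ∧ w = x * y - ε γ γ' • (y * x)}

/-- `F₁[D]`. -/
noncomputable def F1D (D : Submodule F (Module.End F A)) : Subalgebra F (Module.End F A) :=
  Algebra.adjoin F ((mulL F A '' (F1 D : Set A)) ∪ (D : Set (Module.End F A)))

/-- `𝒟 = Der^ε(A) ∩ F₁[D]`. -/
def DScr (𝒜 : Γ → Submodule F A) (ε : Γ → Γ → F) (D : Submodule F (Module.End F A)) :
    Set (Module.End F A) :=
  {f | f ∈ F1D D ∧ f ∈ DerE 𝒜 ε}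

variable {I : Type} [LinearOrder I]

/-- ordered product `d^α`. -/
noncomputable def dpow (d : I → Module.End F A) (α : I →₀ ℕ) : Module.End F A :=
  ((α.support.sort (· ≤ ·)).map fun i => d i ^ α i).prod

/-- membership in the index set 𝒥. -/
def inJ (ε : Γ → Γ → F) (δd : I → Γ) (α : I →₀ ℕ) : Prop :=
  (∀ i, ringChar F ≠ 0 → α i ≤ ringChar F - 1) ∧
  (∀ i, ε (δd i) (δd i) = -1 → α i ≤ 1)

/-- the degree of `d^α`. -/
def degJ (δd : I → Γ) (α : I →₀ ℕ) : Γ := α.sum fun i n => n • δd i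

/-- the subalgebra `S` of `End_F(A)` is Γ-graded simple. -/
def GradedSimpleAlgOn (𝒜 : Γ → Submodule F A) (S : Subalgebra F (Module.End F A)) : Prop :=
  ∀ L : Submodule F (Module.End F A),
    L ≤ Subalgebra.toSubmodule S →
    (∀ x ∈ S, ∀ y ∈ L, x * y ∈ L ∧ y * x ∈ L) →
    L = Submodule.span F {f | f ∈ L ∧ ∃ δ, IsHomogMap 𝒜 δ f} →
    (L = ⊥ ∨ L = Subalgebra.toSubmodule S)

/-- variant of 𝒥 without characteristic restriction -/
def inJ0 (ε : Γ → Γ → F) (δd : I → Γ) (α : I →₀ ℕ) : Prop :=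
  ∀ i, ε (δd i) (δd i) = -1 → α i ≤ 1

/-- the sum `Σ_{α ∈ J0} B d^α` is direct -/
def DirectOn (d : I → Module.End F A) (J0 : Set (I →₀ ℕ)) (Bs : Set A) : Prop :=
  ∀ (s : Finset (I →₀ ℕ)) (c : (I →₀ ℕ) → A), ↑s ⊆ J0 → (∀ α ∈ s, c α ∈ Bs) →
    (∑ α ∈ s, mulL F A (c α) * dpow d α) = 0 → ∀ α ∈ s, mulL F A (c α) * dpow d α = 0

/-- span of color brackets of homogeneous elements of `M` and `N` -/
def brkE (𝒜 : Γ → Submodule F A) (ε : Γ → Γ → F) (M N : Submodule F (Module.End F A)) :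
    Submodule F (Module.End F A) :=
  Submodule.span F {w | ∃ γ γ' x y, x ∈ M ∧ y ∈ N ∧
    IsHomogMap 𝒜 γ x ∧ IsHomogMap 𝒜 γ' y ∧ w = x * y - ε γ γ' • (y * x)}

/-- A bicharacter is multiplicative in its first argument. -/
theorem IsBichar.add_left {ε : Γ → Γ → F} (h : IsBichar ε) (lam mu nu : Γ) :
    ε (lam + mu) nu = ε lam nu * ε mu nu := by
  have h1 := h.1 (lam + mu) nu
  have h2 := h.1 lam nu
  have h3 := h.1 mu nu
  rw [h.2] at h1
  linear_combination ε lam nu * ε mu nu * h1 - ε (lam + mu) nu * h2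
    - ε (lam + mu) nu * ε lam nu * ε nu lam * h3

/-- For a homogeneous color-derivation `f ∈ D`, the operator `a f(b)` is the color bracket
`[a f, b]`. -/
theorem mulL_mul_apply_mem_Wsub_of_homogeneous
    (𝒜 : Γ → Submodule F A) [GradedAlgebra 𝒜] {ε : Γ → Γ → F}
    {D : Submodule F (Module.End F A)} (hbich : IsBichar ε) (hcomm : IsColorComm 𝒜 ε)
    {f : Module.End F A} (hf : f ∈ D) {δ : Γ} (hder : IsColorDer 𝒜 ε δ f)
    {lam mu : Γ} {a b : A} (ha : a ∈ 𝒜 lam) (hb : b ∈ 𝒜 mu) :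
    mulL F A (a * f b) ∈ Wsub 𝒜 ε D := by
  have hL : ∀ c : A, mulL F A c ∈ AD D := fun c =>
    Algebra.subset_adjoin (Or.inl ⟨c, rfl⟩)
  refine Submodule.subset_span ⟨lam + δ, mu, mulL F A a * f, mulL F A b,
    mul_mem (hL a) (Algebra.subset_adjoin (Or.inr hf)), hL b, ?_, ?_, ?_⟩
  · intro nu c hc
    have := SetLike.mul_mem_graded ha (hder.1 nu c hc)
    rwa [add_left_comm] at this
  · intro nu c hc
    have := SetLike.mul_mem_graded hb hc
    rwa [add_comm] at this
  · ext c
    change a * f b * c = a * f (b * c) - ε (lam + δ) mu • (b * (a * f c))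
    rw [hder.2 mu b hb c, hbich.add_left, mul_add, ← mul_assoc b a, mul_smul_comm,
      ← mul_assoc a b, hcomm lam mu a ha b hb, smul_mul_assoc, smul_smul,
      mul_comm (ε δ mu), add_sub_cancel_right, mul_assoc]

/-- If `f ∈ D` is a homogeneous color-derivation, then `a f(b)` lies in `[A[D], A[D]]`. -/
theorem mulL_mul_apply_mem_Wsub
    (𝒜 : Γ → Submodule F A) [GradedAlgebra 𝒜] {ε : Γ → Γ → F}
    {D : Submodule F (Module.End F A)} (hbich : IsBichar ε) (hcomm : IsColorComm 𝒜 ε)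
    {f : Module.End F A} (hf : f ∈ D) {δ : Γ} (hder : IsColorDer 𝒜 ε δ f) (a b : A) :
    mulL F A (a * f b) ∈ Wsub 𝒜 ε D := by
  induction a using DirectSum.Decomposition.inductionOn 𝒜 with
  | zero => simp
  | add a a' iha iha' => rw [add_mul, map_add]; exact add_mem iha iha'
  | homogeneous a =>
    induction b using DirectSum.Decomposition.inductionOn 𝒜 with
    | zero => simp
    | add b b' ihb ihb' => rw [map_add, mul_add, map_add]; exact add_mem ihb ihb'
    | homogeneous b =>
      exact mulL_mul_apply_mem_Wsub_of_homogeneous 𝒜 hbich hcomm hf hder a.2 b.2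

/-- If `A` is graded `D`-simple and `D ≠ 0`, then the values of the homogeneous
color-derivations in `D` on homogeneous elements generate the unit ideal. -/
theorem span_apply_eq_top
    (𝒜 : Γ → Submodule F A) [GradedAlgebra 𝒜] {ε : Γ → Γ → F}
    {D : Submodule F (Module.End F A)} (hDgr : DGraded 𝒜 ε D) (hDne : D ≠ ⊥)
    (hsimple : GradedDSimple 𝒜 D) :
    Ideal.span {x : A | ∃ f ∈ D, ∃ δ, IsColorDer 𝒜 ε δ f ∧ ∃ lam, ∃ b ∈ 𝒜 lam, x = f b} = ⊤ := by
  set I : Ideal A :=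
    Ideal.span {x : A | ∃ f ∈ D, ∃ δ, IsColorDer 𝒜 ε δ f ∧ ∃ lam, ∃ b ∈ 𝒜 lam, x = f b}
  have hmem : ∀ f ∈ D, ∀ b, f b ∈ I := by
    intro f hf b
    rw [hDgr] at hf
    induction hf using Submodule.span_induction with
    | zero => exact I.zero_mem
    | add f g _ _ ihf ihg => exact I.add_mem ihf ihg
    | smul c f _ ihf => exact Submodule.smul_of_tower_mem I c ihf
    | mem f hf =>
      obtain ⟨hfD, δ, hder⟩ := hf
      induction b using DirectSum.Decomposition.inductionOn 𝒜 with
      | zero => simp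
      | add b b' ihb ihb' => rw [map_add]; exact I.add_mem ihb ihb'
      | homogeneous b => exact Ideal.subset_span ⟨f, hfD, δ, hder, _, b, b.2, rfl⟩
  have hhom : I.IsHomogeneous 𝒜 := by
    apply Ideal.homogeneous_span
    rintro _ ⟨f, -, δ, hder, lam, b, hb, rfl⟩
    exact ⟨lam + δ, hder.1 lam b hb⟩
  refine (hsimple I hhom fun f hf x _ => hmem f hf x).resolve_left fun hbot => hDne ?_
  rw [eq_bot_iff]
  intro f hf
  rw [Submodule.mem_bot]
  ext b
  simpa [hbot] using hmem f hf b

theorem stmt_5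
    (𝒜 : Γ → Submodule F A) [GradedAlgebra 𝒜] (ε : Γ → Γ → F)
    (D : Submodule F (Module.End F A))
    (hchar : (2 : F) ≠ 0)
    (hbich : IsBichar ε)
    (hcomm : IsColorComm 𝒜 ε)
    (hDder : D ≤ DerE 𝒜 ε)
    (hDgr : DGraded 𝒜 ε D)
    (hDcc : DColorComm 𝒜 ε D)
    (hDne : D ≠ ⊥)
    (hsimple : GradedDSimple 𝒜 D)
    :
    ∀ a : A, mulL F A a ∈ Wsub 𝒜 ε D := by
  have key : ∀ x : A, ∀ c : A, mulL F A (c * x) ∈ Wsub 𝒜 ε D := by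
    intro x
    have hx : x ∈ (⊤ : Ideal A) := Submodule.mem_top
    rw [← span_apply_eq_top 𝒜 hDgr hDne hsimple] at hx
    induction hx using Submodule.span_induction with
    | zero => simp
    | add x y _ _ ihx ihy =>
      intro c
      rw [mul_add, map_add]
      exact add_mem (ihx c) (ihy c)
    | smul r x _ ihx =>
      intro c
      rw [smul_eq_mul, ← mul_assoc]
      exact ihx (c * r)
    | mem x hx =>
      obtain ⟨f, hf, δ, hder, -, b, -, rfl⟩ := hx
      exact fun c => mulL_mul_apply_mem_Wsub 𝒜 hbich hcomm hf hder c b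
  intro a
  simpa using key a 1
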